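/- Mean field limit of kernels (existence): Let k^{[M]} : X^M × X^M → ℝ be a sequence of kernels that are (i) permutation-invariant in each argument, (ii) uniformly bounded by C_k, and (iii) uniformly continuous with respect to empirical measures with a common modulus ω_k. Then there exists a subsequence (M_ℓ) and a continuous, bounded, symmetric positive definite kernel k : 𝒫(X) × 𝒫(X) → ℝ such that sup_{x,x′ ∈ X^{M_ℓ}} |k^{[M_ℓ]}(x,x′) − k(μ̂[x], μ̂[x′])| → 0 as ℓ → ∞. -/

import Mathlib

open MeasureTheory ENNReal

/-- Kantorovich–Rubinstein (Wasserstein-1 dual) distance between two measures. -/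
noncomputable def dKR {X : Type*} [MeasurableSpace X] [MetricSpace X]
    (μ ν : Measure X) : ℝ :=
  sSup {r : ℝ | ∃ φ : X → ℝ, LipschitzWith 1 φ ∧
    r = ∫ x, φ x ∂μ - ∫ x, φ x ∂ν}

/-- Empirical measure of a tuple. -/
noncomputable def emp {X : Type*} [MeasurableSpace X] {M : ℕ} (x : Fin M → X) :
    Measure X :=
  ((M : ℝ≥0∞))⁻¹ • ∑ i, Measure.dirac (x i)

/-- Empirical measure as a probability measure. -/
noncomputable def empP {X : Type*} [MeasurableSpace X] {M : ℕ} (x : Fin (M + 1) → X) :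
    ProbabilityMeasure X :=
  ⟨emp x, by
    constructor
    simp only [emp, Measure.smul_apply, Measure.finset_sum_apply,
      Measure.dirac_apply' _ MeasurableSet.univ, Set.indicator_univ, smul_eq_mul]
    simp only [Pi.one_apply, Finset.sum_const, Finset.card_univ, Fintype.card_fin,
      nsmul_eq_mul, mul_one]
    rw [ENNReal.inv_mul_cancel] <;> simp⟩

section helpers

open Filter Topology ProbabilityTheory

variable {X : Type*} [MetricSpace X] [CompactSpace X] [MeasurableSpace X] [BorelSpace X]

lemma lip_integrable (μ : ProbabilityMeasure X) {f : X → ℝ} (hf : LipschitzWith 1 f) :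
    Integrable f (μ : Measure X) :=
  (BoundedContinuousFunction.mkOfCompact ⟨f, hf.continuous⟩).integrable (μ : Measure X)

lemma lip_bound (μ ν : ProbabilityMeasure X) {f : X → ℝ} (hf : LipschitzWith 1 f) :
    ∫ x, f x ∂(μ : Measure X) - ∫ x, f x ∂(ν : Measure X)
      ≤ 2 * Metric.diam (Set.univ : Set X) := by
  obtain ⟨x0⟩ : Nonempty X := μ.nonempty
  have hb : ∀ x, |f x - f x0| ≤ Metric.diam (Set.univ : Set X) := fun x => by
    have h1 := hf.dist_le_mul x x0
    have h2 := Metric.dist_le_diam_of_mem (isCompact_univ : IsCompact (Set.univ : Set X)).isBounded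
      (Set.mem_univ x) (Set.mem_univ x0)
    rw [Real.dist_eq] at h1
    simp at h1
    linarith
  have h1 : ∫ x, f x ∂(μ : Measure X) ≤ ∫ x, (f x0 + Metric.diam (Set.univ : Set X)) ∂(μ : Measure X) :=
    integral_mono (lip_integrable μ hf) (integrable_const _)
      (fun x => by have := abs_le.1 (hb x); simp only; linarith)
  have h2 : ∫ x, (f x0 - Metric.diam (Set.univ : Set X)) ∂(ν : Measure X) ≤ ∫ x, f x ∂(ν : Measure X) :=
    integral_mono (integrable_const _) (lip_integrable ν hf)
      (fun x => by have := abs_le.1 (hb x); simp only; linarith)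
  simp at h1 h2
  linarith

lemma le_dKR (μ ν : ProbabilityMeasure X) {f : X → ℝ} (hf : LipschitzWith 1 f) :
    ∫ x, f x ∂(μ : Measure X) - ∫ x, f x ∂(ν : Measure X) ≤ dKR (μ : Measure X) ν := by
  apply le_csSup
  · refine ⟨2 * Metric.diam (Set.univ : Set X), ?_⟩
    rintro r ⟨g, hg, rfl⟩
    exact lip_bound μ ν hg
  · exact ⟨f, hf, rfl⟩

lemma dKR_le (μ ν : ProbabilityMeasure X) {c : ℝ} (h : ∀ f : X → ℝ, LipschitzWith 1 f →
    ∫ x, f x ∂(μ : Measure X) - ∫ x, f x ∂(ν : Measure X) ≤ c) : dKR (μ : Measure X) ν ≤ c := by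
  apply csSup_le
  · exact ⟨_, fun _ => 0, LipschitzWith.const' 0, rfl⟩
  · rintro r ⟨g, hg, rfl⟩
    exact h g hg

lemma dKR_nonneg' (μ ν : ProbabilityMeasure X) : 0 ≤ dKR (μ : Measure X) ν := by
  simpa using le_dKR μ ν (f := fun _ => 0) (LipschitzWith.const' 0)

lemma dKR_comm' (μ ν : ProbabilityMeasure X) : dKR (μ : Measure X) ν = dKR (ν : Measure X) μ := by
  have key : ∀ μ ν : ProbabilityMeasure X, dKR (μ : Measure X) ν ≤ dKR (ν : Measure X) μ := by
    intro μ ν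
    refine dKR_le μ ν fun f hf => ?_
    have := le_dKR ν μ hf.neg
    simp only [Pi.neg_apply, integral_neg] at this
    linarith
  exact le_antisymm (key _ _) (key _ _)

lemma dKR_tri (μ ν ρ : ProbabilityMeasure X) :
    dKR (μ : Measure X) ρ ≤ dKR (μ : Measure X) ν + dKR (ν : Measure X) ρ := by
  refine dKR_le μ ρ fun f hf => ?_
  have := le_dKR μ ν hf
  have := le_dKR ν ρ hf
  linarith

lemma dKR_net [Nonempty X] {ε : ℝ} (hε : 0 < ε) : ∃ S : Set (BoundedContinuousFunction X ℝ),
    S.Finite ∧ ∀ μ ν : ProbabilityMeasure X,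
      (∀ f ∈ S, |∫ x, f x ∂(μ : Measure X) - ∫ x, f x ∂(ν : Measure X)| ≤ ε) →
      dKR (μ : Measure X) ν ≤ 3 * ε := by
  obtain ⟨x0⟩ := ‹Nonempty X›
  set D := Metric.diam (Set.univ : Set X)
  let A : Set (BoundedContinuousFunction X ℝ) := {f | LipschitzWith 1 f ∧ f x0 = 0}
  have hA : IsCompact (closure A) := by
    refine BoundedContinuousFunction.arzela_ascoli (Metric.closedBall 0 D)
      (isCompact_closedBall _ _) A ?_ ?_
    · rintro f x ⟨hf, h0⟩
      have h1 := hf.dist_le_mul x x0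
      have h2 := Metric.dist_le_diam_of_mem
        (isCompact_univ : IsCompact (Set.univ : Set X)).isBounded
        (Set.mem_univ x) (Set.mem_univ x0)
      rw [h0] at h1
      simp only [NNReal.coe_one, one_mul] at h1
      exact h1.trans h2
    · refine (LipschitzWith.uniformEquicontinuous _ 1 ?_).equicontinuous
      exact fun f => f.2.1
  obtain ⟨S, -, hSf, hS⟩ := Metric.totallyBounded_iff.1 (hA.totallyBounded.subset subset_closure)
    ε hε |>.imp fun t ht => (⟨trivial, ht⟩ : True ∧ _)
  refine ⟨S, hSf, fun μ ν h => dKR_le μ ν fun f hf => ?_⟩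
  let g : BoundedContinuousFunction X ℝ :=
    BoundedContinuousFunction.mkOfCompact ⟨fun x => f x - f x0, by
      have := hf.continuous; fun_prop⟩
  have hg : g ∈ A := by
    refine ⟨?_, by simp [g]⟩
    refine LipschitzWith.of_dist_le_mul fun x y => ?_
    have := hf.dist_le_mul x y
    simpa [g] using this
  obtain ⟨s, hs, hgs⟩ := Set.mem_iUnion₂.1 (hS hg)
  have hgs' : ∀ x, |g x - s x| ≤ ε := fun x =>
    (BoundedContinuousFunction.dist_coe_le_dist (f := g) (g := s) x).trans (Metric.mem_ball.1 hgs).le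
  have hgf : ∀ ρ : ProbabilityMeasure X,
      ∫ x, g x ∂(ρ : Measure X) = ∫ x, f x ∂(ρ : Measure X) - f x0 := fun ρ => by
    have : ∀ x, g x = f x - f x0 := fun x => rfl
    simp only [this]
    rw [integral_sub (lip_integrable ρ hf) (integrable_const _)]
    simp
  have hclose : ∀ ρ : ProbabilityMeasure X,
      |∫ x, g x ∂(ρ : Measure X) - ∫ x, s x ∂(ρ : Measure X)| ≤ ε := fun ρ => by
    rw [← integral_sub (g.integrable _) (s.integrable _)]
    have := norm_integral_le_of_norm_le_const (μ := (ρ : Measure X)) (f := fun x => g x - s x)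
      (C := ε) (Eventually.of_forall hgs')
    simpa using this
  have h1 := abs_le.1 (hclose μ)
  have h2 := abs_le.1 (hclose ν)
  have h3 := abs_le.1 (h s hs)
  have h4 := hgf μ
  have h5 := hgf ν
  linarith

lemma dKR_nhds (μ : ProbabilityMeasure X) {ε : ℝ} (hε : 0 < ε) :
    ∀ᶠ ν : ProbabilityMeasure X in 𝓝 μ, dKR (ν : Measure X) μ < ε := by
  have : Nonempty X := μ.nonempty
  obtain ⟨S, hSf, hS⟩ := dKR_net (X := X) (ε := ε / 4) (by linarith)
  have : ∀ᶠ ν : ProbabilityMeasure X in 𝓝 μ, ∀ f ∈ S,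
      |∫ x, f x ∂(ν : Measure X) - ∫ x, f x ∂(μ : Measure X)| ≤ ε / 4 := by
    rw [eventually_all_finite hSf]
    intro f _
    have h := (ProbabilityMeasure.continuous_integral_boundedContinuousFunction (X := X) f).tendsto μ
    have := (Metric.tendsto_nhds.1 h) (ε / 4) (by linarith)
    filter_upwards [this] with ν hν
    exact hν.le
  filter_upwards [this] with ν hν
  have := hS ν μ hν
  linarith

lemma emp_integral {M : ℕ} (x : Fin (M + 1) → X) (f : BoundedContinuousFunction X ℝ) :
    ∫ a, f a ∂(emp x) = (∑ i, f (x i)) / ((M + 1 : ℕ) : ℝ) := by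
  unfold emp
  rw [integral_smul_measure, integral_finsetSum_measure (fun i _ => f.integrable _)]
  simp [integral_dirac, div_eq_inv_mul, ENNReal.toReal_inv]
  left
  norm_cast

lemma exists_seq (μ : ProbabilityMeasure X) : ∃ y : ℕ → X,
    Tendsto (fun M : ℕ => dKR (emp (fun i : Fin (M + 1) => y i)) μ) atTop (𝓝 0) := by
  have : Nonempty X := μ.nonempty
  have hnet := fun n : ℕ => dKR_net (X := X) (ε := 1 / ((n : ℝ) + 1)) (by positivity)
  choose S hSf hS using hnet
  let P : Measure (ℕ → X) := Measure.infinitePi fun _ => (μ : Measure X)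
  have hsl : ∀ f : BoundedContinuousFunction X ℝ, ∀ᵐ y ∂P,
      Tendsto (fun n : ℕ => (∑ i ∈ Finset.range n, f (y i)) / n) atTop
        (𝓝 (∫ x, f x ∂(μ : Measure X))) := by
    intro f
    have hm : ∀ i : ℕ, MeasurePreserving (fun y : ℕ → X => y i) P (μ : Measure X) := fun i =>
      measurePreserving_eval_infinitePi (fun _ : ℕ => (μ : Measure X)) i
    have hfm : Measurable f := f.continuous.measurable
    have key := strong_law_ae_real (μ := P) (fun i y => f (y i)) ?_ ?_ ?_
    · have h0 : ∫ y, f (y 0) ∂P = ∫ x, f x ∂(μ : Measure X) := by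
        rw [← (hm 0).map_eq, integral_map (hm 0).measurable.aemeasurable
          hfm.aestronglyMeasurable]
      rw [h0] at key
      exact key
    · exact (hm 0).integrable_comp_of_integrable (f.integrable _)
    · intro i j hij
      exact (iIndepFun_infinitePi (P := fun _ : ℕ => (μ : Measure X)) (X := fun _ => f)
        (fun _ => hfm)).indepFun hij
    · intro i
      refine ⟨(hfm.comp (hm i).measurable).aemeasurable, (hfm.comp (hm 0).measurable).aemeasurable, ?_⟩
      have : ∀ i, P.map (fun y => f (y i)) = (μ : Measure X).map f := fun i => by
        rw [← (hm i).map_eq, Measure.map_map hfm (hm i).measurable]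
        rfl
      rw [this, this]
  have hall : ∀ᵐ y ∂P, ∀ n, ∀ f ∈ S n,
      Tendsto (fun n : ℕ => (∑ i ∈ Finset.range n, f (y i)) / n) atTop
        (𝓝 (∫ x, f x ∂(μ : Measure X))) := by
    rw [ae_all_iff]
    intro n
    rw [ae_ball_iff (hSf n).countable]
    exact fun f _ => hsl f
  obtain ⟨y, hy⟩ := hall.exists
  refine ⟨y, ?_⟩
  rw [Metric.tendsto_nhds]
  intro ε hε
  obtain ⟨n, hn⟩ := exists_nat_one_div_lt (show 0 < ε / 3 by linarith)
  have : ∀ᶠ M : ℕ in atTop, ∀ f ∈ S n,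
      |∫ x, f x ∂(empP (fun i : Fin (M + 1) => y i) : Measure X) - ∫ x, f x ∂(μ : Measure X)|
        ≤ 1 / ((n : ℝ) + 1) := by
    rw [eventually_all_finite (hSf n)]
    intro f hf
    have h1 := (hy n f hf).comp (tendsto_add_atTop_nat 1)
    filter_upwards [(Metric.tendsto_nhds.1 h1) (1 / ((n : ℝ) + 1)) (by positivity)] with M hM
    have h2 : ∫ x, f x ∂(empP (fun i : Fin (M + 1) => y i) : Measure X) = _ :=
      emp_integral (fun i : Fin (M + 1) => y i) f
    rw [h2, Fin.sum_univ_eq_sum_range (fun i => f (y i))]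
    exact hM.le
  filter_upwards [this] with M hM
  have h1 := hS n _ _ hM
  have h2 := dKR_nonneg' (empP (fun i : Fin (M + 1) => y i)) μ
  change dist (dKR (empP (fun i : Fin (M + 1) => y i) : Measure X) μ) 0 < ε
  rw [Real.dist_eq, sub_zero, abs_of_nonneg h2]
  linarith

end helpers

theorem mean_field_limit_of_kernels
    {X : Type*} [MetricSpace X] [CompactSpace X] [MeasurableSpace X] [BorelSpace X]
    (k : ∀ M : ℕ, (Fin (M + 1) → X) → (Fin (M + 1) → X) → ℝ)
    (Ck : ℝ) (ω : ℝ → ℝ)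
    (hcont : Continuous ω) (hmono : Monotone ω) (hzero : ω 0 = 0)
    (hsym : ∀ M x x', k M x x' = k M x' x)
    (hpd : ∀ (M N : ℕ) (p : Fin N → (Fin (M + 1) → X)) (α : Fin N → ℝ),
      0 ≤ ∑ i, ∑ j, α i * α j * k M (p j) (p i))
    (hperm : ∀ (M : ℕ) (σ : Equiv.Perm (Fin (M + 1))) (x x' : Fin (M + 1) → X),
      k M (x ∘ σ) x' = k M x x')
    (hbdd : ∀ M x x', |k M x x'| ≤ Ck)
    (hucont : ∀ (M : ℕ) (x₁ x₂ x₁' x₂' : Fin (M + 1) → X),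
      |k M x₁ x₁' - k M x₂ x₂'| ≤ ω (dKR (emp x₁) (emp x₂) + dKR (emp x₁') (emp x₂'))) :
    ∃ φ : ℕ → ℕ, StrictMono φ ∧
      ∃ K : ProbabilityMeasure X → ProbabilityMeasure X → ℝ,
        Continuous (fun p : ProbabilityMeasure X × ProbabilityMeasure X => K p.1 p.2) ∧
        (∀ μ ν, |K μ ν| ≤ Ck) ∧
        (∀ μ ν, K μ ν = K ν μ) ∧
        (∀ (N : ℕ) (p : Fin N → ProbabilityMeasure X) (α : Fin N → ℝ),
          0 ≤ ∑ i, ∑ j, α i * α j * K (p j) (p i)) ∧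
        Filter.Tendsto (fun ℓ => ⨆ x : (Fin (φ ℓ + 1) → X) × (Fin (φ ℓ + 1) → X),
            |k (φ ℓ) x.1 x.2 - K (empP x.1) (empP x.2)|) Filter.atTop (nhds 0) := by
  classical
  choose y hy using fun μ : ProbabilityMeasure X => exists_seq μ
  let xs : ∀ M : ℕ, ProbabilityMeasure X → Fin (M + 1) → X := fun M μ i => y μ i
  let a : ℕ → ProbabilityMeasure X → ℝ := fun M μ => dKR (empP (xs M μ) : Measure X) μ
  let U : Ultrafilter ℕ := Filter.hyperfilter ℕ
  have hU : (U : Filter ℕ) ≤ Filter.atTop := Nat.hyperfilter_le_atTop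
  have ha : ∀ μ, Filter.Tendsto (fun M => a M μ) U (nhds 0) := fun μ => (hy μ).mono_left hU
  have hex : ∀ μ ν, ∃ L, Filter.Tendsto (fun M => k M (xs M μ) (xs M ν)) U (nhds L) := by
    intro μ ν
    obtain ⟨L, -, hL⟩ := (isCompact_Icc (a := -Ck) (b := Ck)).ultrafilter_le_nhds
      (U.map (fun M => k M (xs M μ) (xs M ν))) (by
        rw [Filter.le_principal_iff, Ultrafilter.coe_map, Filter.mem_map]
        exact Filter.Eventually.of_forall fun M => abs_le.1 (hbdd M _ _))
    exact ⟨L, hL⟩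
  choose K hK using hex
  have hu : ∀ (M : ℕ) (x₁ x₂ x₁' x₂' : Fin (M + 1) → X) (t : ℝ),
      dKR (empP x₁ : Measure X) (empP x₂) + dKR (empP x₁' : Measure X) (empP x₂') ≤ t →
      |k M x₁ x₁' - k M x₂ x₂'| ≤ ω t := fun M x₁ x₂ x₁' x₂' t ht =>
    (hucont M x₁ x₂ x₁' x₂').trans (hmono ht)
  have hKω : ∀ μ ν μ' ν' : ProbabilityMeasure X, |K μ ν - K μ' ν'| ≤
      ω (dKR (μ : Measure X) μ' + dKR (ν : Measure X) ν') := by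
    intro μ ν μ' ν'
    have h1 : Filter.Tendsto (fun M => |k M (xs M μ) (xs M ν) - k M (xs M μ') (xs M ν')|) U
        (nhds |K μ ν - K μ' ν'|) := ((hK μ ν).sub (hK μ' ν')).abs
    have h2 : Filter.Tendsto (fun M => ω ((a M μ + dKR (μ : Measure X) μ' + a M μ') +
        (a M ν + dKR (ν : Measure X) ν' + a M ν'))) U
        (nhds (ω ((0 + dKR (μ : Measure X) μ' + 0) + (0 + dKR (ν : Measure X) ν' + 0)))) :=
      (hcont.tendsto _).comp ((((ha μ).add_const _).add (ha μ')).add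
        (((ha ν).add_const _).add (ha ν')))
    simp only [zero_add, add_zero] at h2
    refine le_of_tendsto_of_tendsto' h1 h2 fun M => hu M _ _ _ _ _ ?_
    have t1 := dKR_tri (empP (xs M μ)) μ (empP (xs M μ'))
    have t2 := dKR_tri μ μ' (empP (xs M μ'))
    have t3 := dKR_tri (empP (xs M ν)) ν (empP (xs M ν'))
    have t4 := dKR_tri ν ν' (empP (xs M ν'))
    have c1 := dKR_comm' μ' (empP (xs M μ'))
    have c2 := dKR_comm' ν' (empP (xs M ν'))
    simp only [a]
    linarith
  have hω : ∀ ε > 0, ∃ δ > 0, ∀ t, t ≤ δ → ω t < ε := by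
    intro ε hε
    have h := hcont.tendsto 0
    rw [hzero] at h
    obtain ⟨δ, hδ, h'⟩ := Metric.eventually_nhds_iff.1 ((Metric.tendsto_nhds.1 h) ε hε)
    refine ⟨δ / 2, by linarith, fun t ht => (hmono ht).trans_lt ?_⟩
    have := h' (y := δ / 2) (by rw [Real.dist_eq, sub_zero, abs_of_pos] <;> linarith)
    rw [Real.dist_eq, sub_zero] at this
    exact (abs_lt.1 this).2
  have hunif : ∀ ε > 0, ∀ᶠ M in (U : Filter ℕ), ∀ x x' : Fin (M + 1) → X,
      |k M x x' - K (empP x) (empP x')| ≤ ε := by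
    intro ε hε
    obtain ⟨δ, hδ, hωδ⟩ := hω (ε / 3) (by linarith)
    obtain ⟨T, hT⟩ := CompactSpace.elim_nhds_subcover
      (fun μ : ProbabilityMeasure X => {ν : ProbabilityMeasure X | dKR (ν : Measure X) μ < δ / 4})
      (fun μ => dKR_nhds μ (by linarith))
    have hcov : ∀ ν : ProbabilityMeasure X, ∃ μ ∈ T, dKR (ν : Measure X) μ < δ / 4 := by
      intro ν
      have : ν ∈ (⊤ : Set (ProbabilityMeasure X)) := trivial
      rw [← hT] at this
      simpa using this
    have e1 : ∀ᶠ M in (U : Filter ℕ), ∀ μ ∈ T, a M μ < δ / 4 := by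
      rw [Filter.eventually_all_finset]
      exact fun μ _ => (ha μ).eventually_lt_const (by linarith)
    have e2 : ∀ᶠ M in (U : Filter ℕ), ∀ μ ∈ T, ∀ ν ∈ T,
        |k M (xs M μ) (xs M ν) - K μ ν| < ε / 3 := by
      rw [Filter.eventually_all_finset]
      intro μ _
      rw [Filter.eventually_all_finset]
      intro ν _
      exact (Metric.tendsto_nhds.1 (hK μ ν)) (ε / 3) (by linarith)
    filter_upwards [e1, e2] with M h1 h2 x x'
    obtain ⟨μ, hμ, hxμ⟩ := hcov (empP x)
    obtain ⟨ν, hν, hxν⟩ := hcov (empP x')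
    have b1 : |k M x x' - k M (xs M μ) (xs M ν)| ≤ ω δ := by
      refine hu M _ _ _ _ _ ?_
      have t1 := dKR_tri (empP x) μ (empP (xs M μ))
      have t2 := dKR_tri (empP x') ν (empP (xs M ν))
      have c1 := dKR_comm' μ (empP (xs M μ))
      have c2 := dKR_comm' ν (empP (xs M ν))
      have a1 := h1 μ hμ
      have a2 := h1 ν hν
      simp only [a] at a1 a2
      linarith
    have b2 := h2 μ hμ ν hν
    have b3 := hKω (empP x) (empP x') μ ν
    have b4 := hωδ δ le_rfl
    have b5 := hωδ (dKR (empP x : Measure X) μ + dKR (empP x' : Measure X) ν) (by linarith)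
    have b6 := abs_le.1 b1
    have b7 := abs_lt.1 b2
    have b8 := abs_le.1 b3
    rw [abs_le]
    constructor <;> linarith
  obtain ⟨φ, hφ, hφ'⟩ := Filter.extraction_forall_of_frequently
    (P := fun n M => ∀ x x' : Fin (M + 1) → X,
      |k M x x' - K (empP x) (empP x')| ≤ 1 / ((n : ℝ) + 1))
    (fun n => ((hunif (1 / ((n : ℝ) + 1)) (by positivity)).frequently).filter_mono hU)
  refine ⟨φ, hφ, K, ?_, ?_, ?_, ?_, ?_⟩
  · rw [continuous_iff_continuousAt]
    rintro ⟨μ, ν⟩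
    rw [ContinuousAt, Metric.tendsto_nhds]
    intro ε hε
    obtain ⟨δ, hδ, hωδ⟩ := hω ε hε
    have := (dKR_nhds μ (show 0 < δ / 2 by linarith)).prod_nhds
      (dKR_nhds ν (show 0 < δ / 2 by linarith))
    filter_upwards [this] with p hp
    exact (hKω _ _ _ _).trans_lt (hωδ _ (by linarith [hp.1, hp.2]))
  · intro μ ν
    have h : Filter.Tendsto (fun M => |k M (xs M μ) (xs M ν)|) U (nhds |K μ ν|) := (hK μ ν).abs
    exact le_of_tendsto' h fun M => hbdd M _ _
  · intro μ ν
    refine tendsto_nhds_unique (hK μ ν) ?_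
    simp only [hsym _ (xs _ μ) (xs _ ν)]
    exact hK ν μ
  · intro N p α
    have : Filter.Tendsto (fun M => ∑ i, ∑ j, α i * α j * k M (xs M (p j)) (xs M (p i))) U
        (nhds (∑ i, ∑ j, α i * α j * K (p j) (p i))) :=
      tendsto_finsetSum _ fun i _ => tendsto_finsetSum _ fun j _ => (hK _ _).const_mul _
    exact ge_of_tendsto' this fun M => hpd M N (fun i => xs M (p i)) α
  · refine squeeze_zero (fun ℓ => Real.iSup_nonneg fun _ => abs_nonneg _)
      (fun ℓ => Real.iSup_le (fun x => hφ' ℓ x.1 x.2) (by positivity))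
      tendsto_one_div_add_atTop_nhds_zero_nat
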